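/- arXiv:1511.02235 — 5 statements merged into one kernel-verified Lean document; each statement's English description precedes it below -/
import Mathlib

section
/- For every d ≥ 0 and every x ∈ {0,1}^(4^d), NAND_{2d}(x) = 1 if and only if the vertices s and t are connected in the graph G_d(x). -/
open scoped ENNReal
open scoped Classical

namespace NandTree

/-- The bit-`b` half of an input of length `2^(m+1)`: `b = false` gives the first half,
`b = true` the second half (lexicographic indexing, first bit most significant). -/
def halfInput (m : ℕ) (b : Bool) (x : Fin (2^(m+1)) → Bool) : Fin (2^m) → Bool :=
  fun i => x ⟨(cond b 1 0) * 2^m + i.val, by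
    have h := i.isLt
    have h2 : (2:ℕ)^(m+1) = 2^m * 2 := pow_succ 2 m
    cases b <;> simp only [cond_true, cond_false] <;> omega⟩

/-- The value `NAND_ℓ(x)` of a depth-`ℓ` NAND-tree instance: internal nodes at even
distance from the leaves are OR gates, at odd distance AND gates. -/
def nand : (ℓ : ℕ) → (Fin (2^ℓ) → Bool) → Bool
  | 0, x => x ⟨0, by norm_num⟩
  | (ℓ+1), x =>
    if (ℓ+1) % 2 = 0 then
      nand ℓ (halfInput ℓ false x) || nand ℓ (halfInput ℓ true x)
    else
      nand ℓ (halfInput ℓ false x) && nand ℓ (halfInput ℓ true x)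

/-- Index of a leaf given by a root-to-leaf bit string (lexicographic, first bit most
significant). -/
def leafIdx (s : List Bool) : ℕ := s.foldl (fun n b => 2 * n + cond b 1 0) 0

/-- The value of the leaf reached by bit string `s` in instance `x`. -/
def leafVal (m : ℕ) (x : Fin (2^m) → Bool) (s : List Bool) : Bool :=
  if h : leafIdx s < 2^m then x ⟨leafIdx s, h⟩ else false

/-- Edges of the graph `G_d`: `G_0` has a single edge; each edge `e` of `G_d` is replaced
by four edges `(e, b, c)` in `G_{d+1}`, where `b` selects one of the two length-2 paths
and `c` selects the side (`false`: the `u`-side edge, `true`: the `v`-side edge). -/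
def Edg : ℕ → Type
  | 0 => Unit
  | (d+1) => Edg d × Bool × Bool

/-- Vertices of `G_d`: `G_0` has vertices `s = false`, `t = true`; `G_{d+1}` has the
vertices of `G_d` plus one new middle vertex `(e, b)` for each edge `e` of `G_d` and
each of the two length-2 paths `b` replacing it. -/
def Vtx : ℕ → Type
  | 0 => Bool
  | (d+1) => Vtx d ⊕ (Edg d × Bool)

instance edgFintype : (d : ℕ) → Fintype (Edg d)
  | 0 => inferInstanceAs (Fintype Unit)
  | (d+1) => letI := edgFintype d; inferInstanceAs (Fintype (Edg d × Bool × Bool))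

instance edgDecEq : (d : ℕ) → DecidableEq (Edg d)
  | 0 => inferInstanceAs (DecidableEq Unit)
  | (d+1) => letI := edgDecEq d; inferInstanceAs (DecidableEq (Edg d × Bool × Bool))

instance vtxDecEq : (d : ℕ) → DecidableEq (Vtx d)
  | 0 => inferInstanceAs (DecidableEq Bool)
  | (d+1) => letI := edgDecEq d; letI := vtxDecEq d
             inferInstanceAs (DecidableEq (Vtx d ⊕ (Edg d × Bool)))

/-- The two endpoints of an edge of `G_d`: `ep d e false` is the `u`-end and
`ep d e true` is the `v`-end. -/
def ep : (d : ℕ) → Edg d → Bool → Vtx d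
  | 0, _, k => k
  | (d+1), (e, b, c), k =>
    match c, k with
    | false, false => Sum.inl (ep d e false)
    | false, true  => Sum.inr (e, b)
    | true,  false => Sum.inr (e, b)
    | true,  true  => Sum.inl (ep d e true)

/-- The vertex `s` of `G_d`. -/
def sVtx : (d : ℕ) → Vtx d
  | 0 => false
  | (d+1) => Sum.inl (sVtx d)

/-- The vertex `t` of `G_d`. -/
def tVtx : (d : ℕ) → Vtx d
  | 0 => true
  | (d+1) => Sum.inl (tVtx d)

/-- The label of an edge of `G_d`, a bit string of length `2d`: the edge of `G_0` is
labeled by the empty string, and the four edges replacing an edge labeled `τ` are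
labeled `τ00`, `τ01` (the two edges of the first path, `u`- and `v`-side) and
`τ10`, `τ11` (the two edges of the second path). -/
def elabel : (d : ℕ) → Edg d → List Bool
  | 0, _ => []
  | (d+1), (e, b, c) => elabel d e ++ [b, c]

/-- The input bit of `x` associated with edge `e` of `G_d` (bits of `x` indexed by the
edge labels in lexicographic order). -/
def edgeBit (d : ℕ) (x : Fin (2^(2*d)) → Bool) (e : Edg d) : Bool :=
  leafVal (2*d) x (elabel d e)

/-- Two vertices are adjacent via a kept edge. -/
def adjE {V E : Type} (epf : E → Bool → V) (keep : E → Prop) (u v : V) : Prop :=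
  ∃ e, keep e ∧ ((epf e false = u ∧ epf e true = v) ∨ (epf e false = v ∧ epf e true = u))

/-- `a` and `b` are connected in the (multi)graph with endpoint map `epf`, restricted to
the edges satisfying `keep`. -/
def ConnectedIn {V E : Type} (epf : E → Bool → V) (keep : E → Prop) (a b : V) : Prop :=
  Relation.ReflTransGen (adjE epf keep) a b

/-- Evaluation of the tree on a leaf function indexed by bit strings. -/
def ev : ℕ → (List Bool → Bool) → Bool
  | 0, f => f []
  | (n+1), f =>
    if (n+1) % 2 = 0 then
      ev n (fun s => f (false :: s)) || ev n (fun s => f (true :: s))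
    else
      ev n (fun s => f (false :: s)) && ev n (fun s => f (true :: s))

theorem ev_congr (n : ℕ) : ∀ f g : List Bool → Bool,
    (∀ s, s.length = n → f s = g s) → ev n f = ev n g := by
  induction n with
  | zero => intro f g h; exact h [] rfl
  | succ n ih =>
    intro f g h
    have h0 := ih (fun s => f (false :: s)) (fun s => g (false :: s))
      (fun s hs => h _ (by simp [hs]))
    have h1 := ih (fun s => f (true :: s)) (fun s => g (true :: s))
      (fun s hs => h _ (by simp [hs]))
    simp only [ev, h0, h1]

theorem foldl_idx (s : List Bool) : ∀ a : ℕ,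
    s.foldl (fun n b => 2 * n + cond b 1 0) a = a * 2 ^ s.length + leafIdx s := by
  induction s with
  | nil => intro a; simp [leafIdx]
  | cons b s ih =>
    intro a
    simp only [leafIdx, List.foldl_cons, List.length_cons]
    rw [ih, ih (2 * 0 + _)]
    ring

theorem leafIdx_cons (b : Bool) (s : List Bool) :
    leafIdx (b :: s) = (cond b 1 0) * 2 ^ s.length + leafIdx s := by
  have := foldl_idx s (2 * 0 + cond b 1 0)
  rw [leafIdx, List.foldl_cons, this]
  simp

theorem leafIdx_lt (s : List Bool) : leafIdx s < 2 ^ s.length := by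
  induction s with
  | nil => simp [leafIdx]
  | cons b s ih =>
    rw [leafIdx_cons, List.length_cons, pow_succ]
    cases b <;> simp only [cond_true, cond_false] <;> omega

theorem leafVal_half (m : ℕ) (b : Bool) (x : Fin (2^(m+1)) → Bool) (s : List Bool)
    (hs : s.length = m) : leafVal m (halfInput m b x) s = leafVal (m+1) x (b :: s) := by
  have h1 := leafIdx_lt s
  have h2 := leafIdx_lt (b :: s)
  rw [List.length_cons] at h2
  rw [hs] at h1 h2
  unfold leafVal
  rw [dif_pos h1, dif_pos h2]
  unfold halfInput
  congr 1
  apply Fin.ext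
  simp only [leafIdx_cons, hs]

theorem nand_eq_ev (m : ℕ) : ∀ x : Fin (2^m) → Bool, nand m x = ev m (leafVal m x) := by
  induction m with
  | zero => intro x; simp [nand, ev, leafVal, leafIdx]
  | succ m ih =>
    intro x
    have h (b : Bool) : ev m (leafVal m (halfInput m b x))
        = ev m (fun s => leafVal (m+1) x (b :: s)) :=
      ev_congr m _ _ (fun s hs => leafVal_half m b x s hs)
    simp only [nand, ev, ih, h]

/-- Contraction of the two bottom layers. -/
def contr (f : List Bool → Bool) (s : List Bool) : Bool :=
  (f (s ++ [false, false]) && f (s ++ [false, true])) ||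
    (f (s ++ [true, false]) && f (s ++ [true, true]))

theorem ev_contr (n : ℕ) : ∀ f, ev (n+2) f = ev n (contr f) := by
  induction n with
  | zero => intro f; simp [ev, contr]
  | succ n ih =>
    intro f
    rw [show n + 1 + 2 = (n + 2) + 1 from rfl]
    rw [ev, ih, ih, ev]
    have hp : (n + 2 + 1) % 2 = (n + 1) % 2 := by omega
    rw [hp]
    rfl

theorem ep_old (d : ℕ) (e : Edg d) (b c : Bool) :
    ep (d+1) (e, b, c) c = Sum.inl (ep d e c) := by cases c <;> rfl

theorem ep_new (d : ℕ) (e : Edg d) (b c : Bool) :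
    ep (d+1) (e, b, c) (!c) = Sum.inr (e, b) := by cases c <;> rfl

theorem adjE_iff {V E : Type} (epf : E → Bool → V) (keep : E → Prop) (u v : V) :
    adjE epf keep u v ↔ ∃ e k, keep e ∧ epf e k = u ∧ epf e (!k) = v := by
  constructor
  · rintro ⟨e, h, ⟨h1, h2⟩ | ⟨h1, h2⟩⟩
    · exact ⟨e, false, h, h1, h2⟩
    · exact ⟨e, true, h, h2, h1⟩
  · rintro ⟨e, k, h, h1, h2⟩
    cases k
    · exact ⟨e, h, Or.inl ⟨h1, h2⟩⟩
    · exact ⟨e, h, Or.inr ⟨h2, h1⟩⟩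

/-- Invariant on the vertices reachable from an old vertex `a`. -/
def Inv (d : ℕ) (keep : Edg (d+1) → Prop) (keep' : Edg d → Prop) (a : Vtx d) :
    Vtx d ⊕ (Edg d × Bool) → Prop
  | Sum.inl v => ConnectedIn (ep d) keep' a v
  | Sum.inr (e, b) => ∃ k, keep (e, b, k) ∧ ConnectedIn (ep d) keep' a (ep d e k)

theorem conn_contr (d : ℕ) (keep : Edg (d+1) → Prop) (keep' : Edg d → Prop)
    (hk : ∀ e, keep' e ↔ ∃ b, keep (e, b, false) ∧ keep (e, b, true)) (a v : Vtx d) :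
    ConnectedIn (ep (d+1)) keep (Sum.inl a : Vtx d ⊕ (Edg d × Bool)) (Sum.inl v : Vtx d ⊕ (Edg d × Bool)) ↔
      ConnectedIn (ep d) keep' a v := by
  constructor
  · intro h
    have key : ∀ w : Vtx (d+1), Relation.ReflTransGen (adjE (ep (d+1)) keep)
        (Sum.inl a : Vtx d ⊕ (Edg d × Bool)) w → Inv d keep keep' a w := by
      intro w hw
      induction hw with
      | refl => exact Relation.ReflTransGen.refl
      | tail _ hs ih =>
        rw [adjE_iff] at hs
        obtain ⟨⟨e, b, c⟩, k, hkeep, h1, h2⟩ := hs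
        subst h1 h2
        by_cases hkc : k = c
        · subst hkc
          rw [ep_old] at ih
          rw [ep_new]
          exact ⟨k, hkeep, ih⟩
        · obtain rfl : k = !c := by cases k <;> cases c <;> simp_all
          rw [ep_new] at ih
          rw [Bool.not_not, ep_old]
          obtain ⟨k, hk1, hk2⟩ := ih
          by_cases hkc : k = c
          · subst hkc; exact hk2
          · obtain rfl : c = !k := by cases k <;> cases c <;> simp_all
            refine Relation.ReflTransGen.tail hk2 ((adjE_iff _ _ _ _).2 ⟨e, k, ?_, rfl, rfl⟩)
            refine (hk e).2 ⟨b, ?_⟩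
            cases k
            · exact ⟨hk1, hkeep⟩
            · exact ⟨hkeep, hk1⟩
    exact key _ h
  · intro h
    induction h with
    | refl => exact Relation.ReflTransGen.refl
    | tail _ hs ih =>
      rw [adjE_iff] at hs
      obtain ⟨e, k, hkeep, rfl, rfl⟩ := hs
      obtain ⟨b, hb0, hb1⟩ := (hk e).1 hkeep
      have hb : ∀ c, keep (e, b, c) := by intro c; cases c <;> assumption
      have s1 : adjE (ep (d+1)) keep (Sum.inl (ep d e k) : Vtx d ⊕ (Edg d × Bool))
          (Sum.inr (e, b) : Vtx d ⊕ (Edg d × Bool)) :=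
        (adjE_iff _ _ _ _).2 ⟨(e, b, k), k, hb k, ep_old d e b k, ep_new d e b k⟩
      have s2 : adjE (ep (d+1)) keep (Sum.inr (e, b) : Vtx d ⊕ (Edg d × Bool))
          (Sum.inl (ep d e (!k)) : Vtx d ⊕ (Edg d × Bool)) :=
        (adjE_iff _ _ _ _).2 ⟨(e, b, !k), !(!k), hb _, ep_new d e b (!k), by
          rw [Bool.not_not]; exact ep_old d e b (!k)⟩
      exact Relation.ReflTransGen.tail (Relation.ReflTransGen.tail ih s1) s2

theorem ev_iff (d : ℕ) : ∀ f : List Bool → Bool, ev (2*d) f = true ↔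
    ConnectedIn (ep d) (fun e => f (elabel d e) = true) (sVtx d) (tVtx d) := by
  induction d with
  | zero =>
    intro f
    constructor
    · intro h
      exact Relation.ReflTransGen.single ⟨(), h, Or.inl ⟨rfl, rfl⟩⟩
    · intro h
      rcases Relation.ReflTransGen.cases_head h with h | ⟨_, ⟨_, h, _⟩, _⟩
      · exact absurd h Bool.false_ne_true
      · exact h
  | succ d ih =>
    intro f
    rw [show 2 * (d + 1) = 2 * d + 2 from rfl, ev_contr, ih]
    refine (conn_contr d _ _ ?_ _ _).symm
    intro e
    simp [contr, elabel, Bool.exists_bool]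

/-- For every `d ≥ 0` and every `x ∈ {0,1}^(4^d)`, `NAND_{2d}(x) = 1`
if and only if `s` and `t` are connected in `G_d(x)`. -/
theorem nand_eq_true_iff_connected (d : ℕ) (x : Fin (2^(2*d)) → Bool) :
    nand (2*d) x = true ↔
      ConnectedIn (ep d) (fun e => edgeBit d x e = true) (sVtx d) (tVtx d) := by
  rw [nand_eq_ev]
  exact ev_iff d _

end NandTree
end

section
/- For every d ≥ 0 and every x ∈ {0,1}^(4^d), NAND_{2d}(x) = 0 if and only if the vertices s' and t' are connected in the multigraph G'_d(x). -/
open scoped ENNReal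
open scoped Classical

namespace NandTree

/-- Edges of the multigraph `G'_d`: `G'_0` has a single edge; each edge `e` of `G'_d` is
replaced by four edges `(e, c, b)` in `G'_{d+1}`, where `c` selects the side (`false`:
between `u'` and the middle vertex, `true`: between the middle vertex and `v'`) and `b`
selects one of the two parallel edges on that side. -/
def Edg' : ℕ → Type
  | 0 => Unit
  | (d+1) => Edg' d × Bool × Bool

/-- Vertices of `G'_d`: `G'_0` has vertices `s' = false`, `t' = true`; `G'_{d+1}` has the
vertices of `G'_d` plus one new middle vertex for each edge of `G'_d`. -/
def Vtx' : ℕ → Type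
  | 0 => Bool
  | (d+1) => Vtx' d ⊕ Edg' d

instance edg'Fintype : (d : ℕ) → Fintype (Edg' d)
  | 0 => inferInstanceAs (Fintype Unit)
  | (d+1) => letI := edg'Fintype d; inferInstanceAs (Fintype (Edg' d × Bool × Bool))

instance edg'DecEq : (d : ℕ) → DecidableEq (Edg' d)
  | 0 => inferInstanceAs (DecidableEq Unit)
  | (d+1) => letI := edg'DecEq d; inferInstanceAs (DecidableEq (Edg' d × Bool × Bool))

instance vtx'DecEq : (d : ℕ) → DecidableEq (Vtx' d)
  | 0 => inferInstanceAs (DecidableEq Bool)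
  | (d+1) => letI := edg'DecEq d; letI := vtx'DecEq d
             inferInstanceAs (DecidableEq (Vtx' d ⊕ Edg' d))

/-- The two endpoints of an edge of `G'_d`. -/
def ep' : (d : ℕ) → Edg' d → Bool → Vtx' d
  | 0, _, k => k
  | (d+1), (e, c, _b), k =>
    match c, k with
    | false, false => Sum.inl (ep' d e false)
    | false, true  => Sum.inr e
    | true,  false => Sum.inr e
    | true,  true  => Sum.inl (ep' d e true)

/-- The vertex `s'` of `G'_d`. -/
def sVtx' : (d : ℕ) → Vtx' d
  | 0 => false
  | (d+1) => Sum.inl (sVtx' d)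

/-- The vertex `t'` of `G'_d`. -/
def tVtx' : (d : ℕ) → Vtx' d
  | 0 => true
  | (d+1) => Sum.inl (tVtx' d)

/-- The label of an edge of `G'_d`: the edge of `G'_0` is labeled by the empty string,
and the four edges replacing an edge labeled `τ` are labeled `τ00`, `τ01` (the two
parallel edges between `u'` and the middle vertex) and `τ10`, `τ11` (the two parallel
edges between the middle vertex and `v'`). -/
def elabel' : (d : ℕ) → Edg' d → List Bool
  | 0, _ => []
  | (d+1), (e, c, b) => elabel' d e ++ [c, b]

/-- The input bit of `x` associated with edge `e` of `G'_d`. -/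
def edgeBit' (d : ℕ) (x : Fin (2^(2*d)) → Bool) (e : Edg' d) : Bool :=
  leafVal (2*d) x (elabel' d e)

/-- Evaluate the bottom two layers of the tree. -/
def redInput (m : ℕ) (x : Fin (2^(m+2)) → Bool) : Fin (2^m) → Bool :=
  fun i =>
    have h : i.val < 2^m := i.isLt
    have h2 : (2:ℕ)^(m+2) = 2^m * 4 := by rw [pow_add]; norm_num
    (x ⟨4 * i.val, by omega⟩ && x ⟨4 * i.val + 1, by omega⟩) ||
    (x ⟨4 * i.val + 2, by omega⟩ && x ⟨4 * i.val + 3, by omega⟩)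

theorem half_red (m : ℕ) (b : Bool) (x : Fin (2^(m+3)) → Bool) :
    redInput m (halfInput (m+2) b x) = halfInput m b (redInput (m+1) x) := by
  funext i
  have h2 : (2:ℕ)^(m+2) = 2^m * 4 := by rw [pow_add]; norm_num
  simp only [redInput, halfInput]
  have e : (cond b 1 0) * 2^(m+2) = 4 * ((cond b 1 0) * 2^m) := by rw [h2]; ring
  congr 2 <;> congr 2 <;> omega

theorem nand_red (m : ℕ) (x : Fin (2^(m+2)) → Bool) :
    nand (m+2) x = nand m (redInput m x) := by
  induction m with
  | zero => simp [nand, redInput, halfInput]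
  | succ m ih =>
    have hp : (m+2+1) % 2 = (m+1) % 2 := by omega
    rw [show nand (m+1+2) x = if (m+2+1) % 2 = 0 then
      nand (m+2) (halfInput (m+2) false x) || nand (m+2) (halfInput (m+2) true x)
      else nand (m+2) (halfInput (m+2) false x) && nand (m+2) (halfInput (m+2) true x) from rfl]
    rw [ih, ih, half_red, half_red, hp]
    rfl

theorem leafIdx_append (s : List Bool) (c b : Bool) :
    leafIdx (s ++ [c, b]) = 4 * leafIdx s + 2 * (cond c 1 0) + cond b 1 0 := by
  simp only [leafIdx, List.foldl_append, List.foldl_cons, List.foldl_nil]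
  omega

theorem leafIdx_lt_s2 : (d : ℕ) → (e : Edg' d) → leafIdx (elabel' d e) < 2^(2*d)
  | 0, _ => by simp [leafIdx, elabel']
  | (d+1), (e, c, b) => by
    have ih := leafIdx_lt_s2 d e
    have h2 : (2:ℕ)^(2*(d+1)) = 2^(2*d) * 4 := by rw [mul_add, pow_add]; norm_num
    rw [elabel', leafIdx_append, h2]
    cases c <;> cases b <;> simp only [cond_true, cond_false] <;> omega

theorem edgeBit_red (d : ℕ) (x : Fin (2^(2*(d+1))) → Bool) (e : Edg' d) :
    edgeBit' d (redInput (2*d) x) e =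
      ((edgeBit' (d+1) x (e, false, false) && edgeBit' (d+1) x (e, false, true)) ||
       (edgeBit' (d+1) x (e, true, false) && edgeBit' (d+1) x (e, true, true))) := by
  have key : ∀ c b, ∃ h, edgeBit' (d+1) x (e, c, b) =
      x ⟨4 * leafIdx (elabel' d e) + 2 * (cond c 1 0) + cond b 1 0, h⟩ := by
    intro c b
    have h := leafIdx_lt_s2 (d+1) (e, c, b)
    have h' := h
    rw [elabel', leafIdx_append] at h'
    refine ⟨h', ?_⟩
    unfold edgeBit' leafVal
    rw [dif_pos h]
    congr 2
    rw [elabel', leafIdx_append]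
  obtain ⟨_, h1⟩ := key false false
  obtain ⟨_, h2⟩ := key false true
  obtain ⟨_, h3⟩ := key true false
  obtain ⟨_, h4⟩ := key true true
  rw [h1, h2, h3, h4]
  unfold edgeBit' leafVal
  rw [dif_pos (leafIdx_lt_s2 d e)]
  rfl

/-- The condition that both sides of a replaced edge keep at least one parallel edge. -/
def keepRed (d : ℕ) (keep : Edg' (d+1) → Prop) (e : Edg' d) : Prop :=
  (∃ b, keep (e, false, b)) ∧ (∃ b, keep (e, true, b))

/-- Invariant for vertices reachable from an old vertex. -/
def reachInv (d : ℕ) (keep : Edg' (d+1) → Prop) (a : Vtx' d) : Vtx' d ⊕ Edg' d → Prop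
  | Sum.inl v => ConnectedIn (ep' d) (keepRed d keep) a v
  | Sum.inr e => ∀ c, (∃ b, keep (e, c, b)) →
      ConnectedIn (ep' d) (keepRed d keep) a (ep' d e c)

theorem reachInv_step (d : ℕ) (keep : Edg' (d+1) → Prop) (a : Vtx' d) (e : Edg' d)
    (c : Bool) (hk : ∃ b, keep (e, c, b)) :
    reachInv d keep a (Sum.inl (ep' d e c)) ↔ reachInv d keep a (Sum.inr e) := by
  constructor
  · intro h c' hk'
    rcases c with _ | _ <;> rcases c' with _ | _
    · exact h
    · exact Relation.ReflTransGen.tail h ⟨e, ⟨hk, hk'⟩, Or.inl ⟨rfl, rfl⟩⟩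
    · exact Relation.ReflTransGen.tail h ⟨e, ⟨hk', hk⟩, Or.inr ⟨rfl, rfl⟩⟩
    · exact h
  · intro h
    exact h c hk

theorem connected_red (d : ℕ) (keep : Edg' (d+1) → Prop) (a b : Vtx' d) :
    ConnectedIn (ep' (d+1)) keep (Sum.inl a : Vtx' d ⊕ Edg' d) (Sum.inl b : Vtx' d ⊕ Edg' d) ↔
      ConnectedIn (ep' d) (keepRed d keep) a b := by
  constructor
  · intro h
    have : ∀ w : Vtx' (d+1), ConnectedIn (ep' (d+1)) keep (Sum.inl a : Vtx' d ⊕ Edg' d) w →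
        reachInv d keep a w := by
      intro w hw
      induction hw with
      | refl => exact Relation.ReflTransGen.refl
      | tail _ hs ih =>
        obtain ⟨⟨e, c, b⟩, hk, ⟨h1, h2⟩ | ⟨h1, h2⟩⟩ := hs
        · subst h1 h2
          cases c
          · exact (reachInv_step d keep a e false ⟨b, hk⟩).1 ih
          · exact (reachInv_step d keep a e true ⟨b, hk⟩).2 ih
        · subst h1 h2
          cases c
          · exact (reachInv_step d keep a e false ⟨b, hk⟩).2 ih
          · exact (reachInv_step d keep a e true ⟨b, hk⟩).1 ih
    exact this _ h
  · intro h
    induction h with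
    | refl => exact Relation.ReflTransGen.refl
    | tail _ hs ih =>
      obtain ⟨e, ⟨⟨b1, hk1⟩, ⟨b2, hk2⟩⟩, ⟨h1, h2⟩ | ⟨h1, h2⟩⟩ := hs
      · subst h1 h2
        exact (Relation.ReflTransGen.tail ih ⟨(e, false, b1), hk1, Or.inl ⟨rfl, rfl⟩⟩).tail
          ⟨(e, true, b2), hk2, Or.inl ⟨rfl, rfl⟩⟩
      · subst h1 h2
        exact (Relation.ReflTransGen.tail ih ⟨(e, true, b2), hk2, Or.inr ⟨rfl, rfl⟩⟩).tail
          ⟨(e, false, b1), hk1, Or.inr ⟨rfl, rfl⟩⟩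

/-- For every `d ≥ 0` and every `x ∈ {0,1}^(4^d)`, `NAND_{2d}(x) = 0`
if and only if `s'` and `t'` are connected in `G'_d(x)`. -/
theorem nand_eq_false_iff_connected' (d : ℕ) (x : Fin (2^(2*d)) → Bool) :
    nand (2*d) x = false ↔
      ConnectedIn (ep' d) (fun e => edgeBit' d x e = false) (sVtx' d) (tVtx' d) := by
  induction d with
  | zero =>
    have hb : edgeBit' 0 x () = x ⟨0, by norm_num⟩ := by
      simp [edgeBit', leafVal, leafIdx, elabel']
    constructor
    · intro h
      exact Relation.ReflTransGen.single ⟨(), hb.trans h, Or.inl ⟨rfl, rfl⟩⟩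
    · intro h
      rcases Relation.ReflTransGen.cases_head h with h | ⟨_, ⟨e, hk, _⟩, _⟩
      · exact absurd h Bool.false_ne_true
      · exact hb.symm.trans hk
  | succ d ih =>
    have h1 : nand (2*(d+1)) x = nand (2*d) (redInput (2*d) x) := nand_red (2*d) x
    rw [h1, ih]
    refine Iff.trans ?_ (connected_red d _ _ _).symm
    have : (fun e => edgeBit' d (redInput (2*d) x) e = false) =
        keepRed d (fun e => edgeBit' (d+1) x e = false) := by
      funext e
      rw [edgeBit_red]
      simp only [keepRed, Bool.exists_bool, Bool.or_eq_false_iff, Bool.and_eq_false_iff]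
    rw [this]

end NandTree
end

section
/- For every d ≥ 0, every self-avoiding path from s' to t' in the multigraph G'_d uses exactly 2^d edges. -/
open scoped ENNReal
open scoped Classical

namespace NandTree

/-- A walk from `a` to `b` in a multigraph with endpoint map `epf`, recorded by its list
of edges and its list of visited vertices. -/
inductive Walk {V E : Type} (epf : E → Bool → V) : V → V → List E → List V → Prop
  | nil (v : V) : Walk epf v v [] [v]
  | cons {u v w : V} {e : E} {es : List E} {vs : List V} :
      ((epf e false = u ∧ epf e true = v) ∨ (epf e false = v ∧ epf e true = u)) →
      Walk epf v w es vs → Walk epf u w (e :: es) (u :: vs)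

theorem Walk.start_mem {V E : Type} {epf : E → Bool → V} {a b : V} {es : List E} {vs : List V}
    (h : Walk epf a b es vs) : a ∈ vs := by
  cases h <;> simp

theorem Walk.end_mem {V E : Type} {epf : E → Bool → V} {a b : V} {es : List E} {vs : List V}
    (h : Walk epf a b es vs) : b ∈ vs := by
  induction h with
  | nil v => simp
  | cons _ _ ih => exact List.mem_cons_of_mem _ ih

theorem step_inl {d : ℕ} {a : Vtx' d} {v : Vtx' (d+1)} {x : Edg' (d+1)}
    (h : (ep' (d+1) x false = Sum.inl a ∧ ep' (d+1) x true = v) ∨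
      (ep' (d+1) x false = v ∧ ep' (d+1) x true = Sum.inl a)) :
    v = Sum.inr x.1 ∧ a = ep' d x.1 x.2.1 := by
  obtain ⟨e, c, b⟩ := x
  cases c
  · rcases h with ⟨h1, h2⟩ | ⟨h1, h2⟩
    · exact ⟨h2.symm, (Sum.inl.inj h1).symm⟩
    · exact absurd h2 Sum.inr_ne_inl
  · rcases h with ⟨h1, h2⟩ | ⟨h1, h2⟩
    · exact absurd h1 Sum.inr_ne_inl
    · exact ⟨h1.symm, (Sum.inl.inj h2).symm⟩

theorem step_inr {d : ℕ} {e : Edg' d} {v : Vtx' (d+1)} {x : Edg' (d+1)}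
    (h : (ep' (d+1) x false = Sum.inr e ∧ ep' (d+1) x true = v) ∨
      (ep' (d+1) x false = v ∧ ep' (d+1) x true = Sum.inr e)) :
    x.1 = e ∧ v = Sum.inl (ep' d e x.2.1) := by
  obtain ⟨e', c, b⟩ := x
  cases c
  · rcases h with ⟨h1, h2⟩ | ⟨h1, h2⟩
    · exact absurd h1 Sum.inl_ne_inr
    · have := Sum.inr.inj h2
      subst this
      exact ⟨rfl, h1.symm⟩
  · rcases h with ⟨h1, h2⟩ | ⟨h1, h2⟩
    · have := Sum.inr.inj h1
      subst this
      exact ⟨rfl, h2.symm⟩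
    · exact absurd h2 Sum.inl_ne_inr

theorem Walk.contract {d : ℕ} (n : ℕ) : ∀ (a b : Vtx' d) (es : List (Edg' (d+1)))
    (vs : List (Vtx' (d+1))), es.length ≤ n →
    Walk (ep' (d+1)) (Sum.inl a) (Sum.inl b) es vs → vs.Nodup →
    ∃ (es' : List (Edg' d)) (vs' : List (Vtx' d)), Walk (ep' d) a b es' vs' ∧ vs'.Nodup ∧
      (∀ x ∈ vs', (Sum.inl x : Vtx' d ⊕ Edg' d) ∈ (vs : List (Vtx' d ⊕ Edg' d))) ∧
      es.length = 2 * es'.length := by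
  induction n using Nat.strong_induction_on with
  | _ n ih =>
  intro a b es vs hn hw hnd
  generalize hA : (Sum.inl a : Vtx' d ⊕ Edg' d) = A at hw
  generalize hB : (Sum.inl b : Vtx' d ⊕ Edg' d) = B at hw
  cases hw with
  | nil =>
    have := Sum.inl.inj (hA.trans hB.symm)
    subst this
    refine ⟨[], [a], Walk.nil a, by simp, ?_, rfl⟩
    intro x hx
    rw [List.mem_singleton] at hx
    rw [hx, hA]
    exact List.mem_singleton.2 rfl
  | @cons _ v _ x es1 vs1 hx hw1 =>
    subst hA
    obtain ⟨hv, ha⟩ := step_inl hx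
    subst hv
    generalize hC : (Sum.inr x.1 : Vtx' d ⊕ Edg' d) = C at hw1
    cases hw1 with
    | nil => exact absurd (hB.trans hC.symm) Sum.inl_ne_inr
    | @cons _ v2 _ y es2 vs2 hy hw2 =>
      subst hC
      subst hB
      obtain ⟨hy1, hv2⟩ := step_inr hy
      subst hv2
      have hnd' := List.nodup_cons.1 hnd
      have hnd'' := List.nodup_cons.1 hnd'.2
      have hc : y.2.1 ≠ x.2.1 := by
        intro hc
        apply hnd'.1
        have := hw2.start_mem
        rw [hc, ← ha] at this
        exact List.mem_cons_of_mem _ this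
      simp only [List.length_cons] at hn
      obtain ⟨es', vs', hw', hn', hm', hl'⟩ :=
        ih es2.length (by omega) _ _ es2 vs2 le_rfl hw2 hnd''.2
      refine ⟨x.1 :: es', a :: vs', Walk.cons ?_ hw', ?_, ?_, ?_⟩
      · rw [ha]
        cases h1 : x.2.1 <;> cases h2 : y.2.1 <;> simp_all
      · refine List.nodup_cons.2 ⟨fun h => hnd'.1 (List.mem_cons_of_mem _ (hm' a h)), hn'⟩
      · intro z hz
        rcases List.mem_cons.1 hz with rfl | hz
        · exact List.mem_cons_self
        · exact List.mem_cons_of_mem _ (List.mem_cons_of_mem _ (hm' z hz))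
      · simp only [List.length_cons]
        omega

/-- Every self-avoiding path from `s'` to `t'` in `G'_d` uses exactly
`2^d` edges. -/
theorem selfAvoiding_path_length (d : ℕ) (es : List (Edg' d)) (vs : List (Vtx' d))
    (hwalk : Walk (ep' d) (sVtx' d) (tVtx' d) es vs) (hsa : vs.Nodup) :
    es.length = 2^d := by
  induction d with
  | zero =>
    generalize hA : sVtx' 0 = A at hwalk
    generalize hB : tVtx' 0 = B at hwalk
    cases hwalk with
    | nil => exact absurd (hA.trans hB.symm) Bool.false_ne_true
    | @cons _ v _ x es1 vs1 hx hw1 =>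
      have hv : v = B := by
        rw [← hB]
        rcases hx with ⟨_, h2⟩ | ⟨_, h2⟩
        · exact h2.symm
        · exact absurd (hA.trans h2.symm) Bool.false_ne_true
      subst hv
      have hnd := List.nodup_cons.1 hsa
      cases hw1 with
      | nil => rfl
      | cons _ hw2 => exact absurd hw2.end_mem (List.nodup_cons.1 hnd.2).1
  | succ d ih =>
    obtain ⟨es', vs', hw', hn', _, hl'⟩ :=
      Walk.contract es.length (sVtx' d) (tVtx' d) es vs le_rfl hwalk hsa
    rw [hl', ih es' vs' hw' hn', pow_succ, mul_comm]

end NandTree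
end

section
/- For every d ≥ 0 and every 1-instance x ∈ {0,1}^(4^d) (i.e., NAND_{2d}(x) = 1), the positive witness size of x in the span program P_{G_d} equals half the effective resistance: w_+(x, P_{G_d}) = (1/2) R_{s,t}(G_d(x)). -/
open scoped ENNReal
open scoped Classical

namespace NandTree

/-- The net flow of `θ` out of vertex `v` (each edge oriented from its `false` endpoint
to its `true` endpoint; a function on oriented edges with `θ(rev e) = -θ(e)` is the same
data as a function on these chosen orientations). -/
noncomputable def netFlow {V E : Type} [Fintype E] (epf : E → Bool → V) (θ : E → ℝ)
    (v : V) : ℝ :=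
  ∑ e, θ e * ((if epf e false = v then (1:ℝ) else 0) - (if epf e true = v then 1 else 0))

/-- `θ` is a unit `s`-`t` flow supported on the kept edges: it vanishes on discarded
edges, has net outflow `1` at `s`, net inflow `1` at `t`, and zero net flow elsewhere. -/
def IsUnitFlow {V E : Type} [Fintype E] (epf : E → Bool → V) (keep : E → Prop)
    (s t : V) (θ : E → ℝ) : Prop :=
  (∀ e, ¬ keep e → θ e = 0) ∧
  (∀ v, netFlow epf θ v = (if v = s then (1:ℝ) else 0) - (if v = t then 1 else 0))

/-- The effective resistance between `s` and `t` in the (multi)graph given by the edges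
satisfying `keep`: the least energy of a unit `s`-`t` flow if `s` and `t` are connected,
and `∞` otherwise. -/
noncomputable def effRes {V E : Type} [Fintype E] (epf : E → Bool → V) (keep : E → Prop)
    (s t : V) : ℝ≥0∞ :=
  if ConnectedIn epf keep s t then
    ⨅ θ ∈ {θ : E → ℝ | IsUnitFlow epf keep s t θ}, ENNReal.ofReal (∑ e, (θ e)^2)
  else ⊤

/-- The positive witness size `w₊(x, P_{G_d})` of the span program `P_{G_d}`: the least
squared norm of a vector `w`, supported on the directed edges available for input `x`
(both orientations `(e, o)` of each edge `e` of `G_d` with `x`-bit `1`), such that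
`A w = |s⟩ - |t⟩` where `A |(e,o)⟩ = |ep e o⟩ - |ep e (!o)⟩`; the infimum over the empty
set being `⊤ = ∞` when no witness exists. -/
noncomputable def posWit (d : ℕ) (x : Fin (2^(2*d)) → Bool) : ℝ≥0∞ :=
  ⨅ w ∈ {w : Edg d × Bool → ℝ |
      (∀ p : Edg d × Bool, w p ≠ 0 → edgeBit d x p.1 = true) ∧
      (∀ v : Vtx d,
        (∑ p : Edg d × Bool, w p *
          ((if ep d p.1 p.2 = v then (1:ℝ) else 0) - (if ep d p.1 (!p.2) = v then 1 else 0)))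
        = (if v = sVtx d then (1:ℝ) else 0) - (if v = tVtx d then 1 else 0))},
    ENNReal.ofReal (∑ p : Edg d × Bool, (w p)^2)

instance vtxFinite : (d : ℕ) → Finite (Vtx d)
  | 0 => inferInstanceAs (Finite Bool)
  | (d+1) => letI := vtxFinite d; inferInstanceAs (Finite (Vtx d ⊕ (Edg d × Bool)))

/-- Cut argument: a unit flow on the kept edges forces `s` and `t` to be connected. -/
theorem connected_of_flow {V E : Type} [Fintype E] [Finite V] (epf : E → Bool → V)
    (keep : E → Prop) (s t : V) (θ : E → ℝ) (hθ : IsUnitFlow epf keep s t θ) :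
    ConnectedIn epf keep s t := by
  by_contra hc
  have := Fintype.ofFinite V
  let f : V → ℝ := fun v => if ConnectedIn epf keep s v then 1 else 0
  have h1 : ∑ v, f v * netFlow epf θ v = 1 := by
    have hs : f s = 1 := if_pos Relation.ReflTransGen.refl
    have ht : f t = 0 := if_neg hc
    simp only [hθ.2, mul_sub, Finset.sum_sub_distrib, mul_ite, mul_one, mul_zero,
      Finset.sum_ite_eq', Finset.mem_univ, if_true, hs, ht, sub_zero]
  have h2 : ∑ v, f v * netFlow epf θ v = 0 := by
    have h3 : ∑ v, f v * netFlow epf θ v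
        = ∑ e, θ e * (f (epf e false) - f (epf e true)) := by
      simp only [netFlow, Finset.mul_sum]
      rw [Finset.sum_comm]
      refine Finset.sum_congr rfl fun e _ => ?_
      have h4 : ∀ v, f v * (θ e * ((if epf e false = v then (1:ℝ) else 0)
          - (if epf e true = v then 1 else 0)))
          = θ e * ((if epf e false = v then f v else 0)
            - (if epf e true = v then f v else 0)) := by
        intro v
        split_ifs <;> ring
      simp only [h4, ← Finset.mul_sum, Finset.sum_sub_distrib, Finset.sum_ite_eq,
        Finset.mem_univ, if_true]
    rw [h3]
    refine Finset.sum_eq_zero fun e _ => ?_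
    by_cases hk : keep e
    · have h5 : ConnectedIn epf keep s (epf e false) ↔ ConnectedIn epf keep s (epf e true) :=
        ⟨fun h => h.tail ⟨e, hk, Or.inl ⟨rfl, rfl⟩⟩, fun h => h.tail ⟨e, hk, Or.inr ⟨rfl, rfl⟩⟩⟩
      have h6 : f (epf e false) = f (epf e true) := by simp only [f, h5]
      rw [h6, sub_self, mul_zero]
    · rw [hθ.1 e hk, zero_mul]
  linarith

/-- The flow obtained from a witness. -/
theorem flow_of_wit (d : ℕ) (x : Fin (2^(2*d)) → Bool) (w : Edg d × Bool → ℝ)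
    (hs : ∀ p : Edg d × Bool, w p ≠ 0 → edgeBit d x p.1 = true)
    (hw : ∀ v : Vtx d,
        (∑ p : Edg d × Bool, w p *
          ((if ep d p.1 p.2 = v then (1:ℝ) else 0) - (if ep d p.1 (!p.2) = v then 1 else 0)))
        = (if v = sVtx d then (1:ℝ) else 0) - (if v = tVtx d then 1 else 0)) :
    IsUnitFlow (ep d) (fun e => edgeBit d x e = true) (sVtx d) (tVtx d)
      (fun e => w (e, false) - w (e, true)) := by
  refine ⟨fun e he => ?_, fun v => ?_⟩
  · have h1 : w (e, false) = 0 := by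
      by_contra h
      exact he (hs _ h)
    have h2 : w (e, true) = 0 := by
      by_contra h
      exact he (hs _ h)
    simp [h1, h2]
  · have h := hw v
    rw [Fintype.sum_prod_type] at h
    simp only [Fintype.sum_bool, Bool.not_true, Bool.not_false] at h
    unfold netFlow
    convert h using 1
    · refine Finset.sum_congr rfl fun e _ => ?_
      split_ifs <;> ring
    · congr

/-- For every `1`-instance `x`,
`w₊(x, P_{G_d}) = (1/2) R_{s,t}(G_d(x))`. -/
theorem posWit_eq_half_effRes (d : ℕ) (x : Fin (2^(2*d)) → Bool)
    (h : nand (2*d) x = true) :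
    posWit d x
      = (1/2 : ℝ≥0∞) * effRes (ep d) (fun e => edgeBit d x e = true) (sVtx d) (tVtx d) := by
  have hhalf : (1/2 : ℝ≥0∞) = ENNReal.ofReal (1/2) := by
    rw [ENNReal.ofReal_div_of_pos (by norm_num)]
    simp
  by_cases hc : ConnectedIn (ep d) (fun e => edgeBit d x e = true) (sVtx d) (tVtx d)
  · rw [effRes, if_pos hc]
    apply le_antisymm
    · rw [ENNReal.mul_iInf_of_ne (by simp) (by simp)]
      refine le_iInf fun θ => ?_
      rw [ENNReal.mul_iInf_of_ne (by simp) (by simp)]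
      refine le_iInf fun hθ => ?_
      obtain ⟨h1, h2⟩ := hθ
      refine (iInf₂_le (fun p : Edg d × Bool => cond p.2 (-(θ p.1 / 2)) (θ p.1 / 2))
        ⟨?_, ?_⟩).trans ?_
      rotate_left
      · rintro ⟨e, b⟩ hp
        by_contra hk
        apply hp
        have h3 := h1 e hk
        cases b <;> simp [h3]
      · intro v
        have h3 := h2 v
        unfold netFlow at h3
        rw [Fintype.sum_prod_type]
        simp only [Fintype.sum_bool, Bool.not_true, Bool.not_false, cond_true, cond_false]
        convert h3 using 1
        · refine Finset.sum_congr rfl fun e _ => ?_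
          split_ifs <;> ring
        · congr
      · rw [hhalf, ← ENNReal.ofReal_mul (by norm_num)]
        apply ENNReal.ofReal_le_ofReal
        rw [Fintype.sum_prod_type, Finset.mul_sum]
        apply Finset.sum_le_sum
        intro e _
        simp only [Fintype.sum_bool, cond_true, cond_false]
        apply le_of_eq
        ring
    · refine le_iInf₂ fun w hw => ?_
      refine (mul_le_mul_right (iInf₂_le _ (flow_of_wit d x w hw.1 hw.2)) _).trans ?_
      rw [hhalf, ← ENNReal.ofReal_mul (by norm_num)]
      apply ENNReal.ofReal_le_ofReal
      rw [Fintype.sum_prod_type, Finset.mul_sum]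
      apply Finset.sum_le_sum
      intro e _
      simp only [Fintype.sum_bool]
      nlinarith [sq_nonneg (w (e, false) + w (e, true))]
  · rw [effRes, if_neg hc, ENNReal.mul_top (by simp)]
    refine top_le_iff.mp (le_iInf₂ fun w hw => ?_)
    exact absurd (connected_of_flow _ _ _ _ _ (flow_of_wit d x w hw.1 hw.2)) hc

end NandTree
end

section
/- For every d ≥ 0 and every x ∈ {0,1}^(4^d), the approximate negative witness size of x in the span program P_{G_d} satisfies w̃_-(x, P_{G_d}) ≤ 2^(d+1). -/
open scoped ENNReal
open scoped Classical

namespace NandTree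

/-- The negative error `e₋(x)` of `x` in `P_{G_d}`: the least value of
`‖ω ∘ A ∘ Π_{H(x)}‖²` (the sum of `(ω(u) - ω(v))²` over the directed edges available for
`x`) over linear functionals `ω` with `ω(|s⟩ - |t⟩) = 1`. -/
noncomputable def negErr (d : ℕ) (x : Fin (2^(2*d)) → Bool) : ℝ :=
  sInf {r : ℝ | ∃ ω : Vtx d → ℝ, ω (sVtx d) - ω (tVtx d) = 1 ∧
    r = ∑ p : Edg d × Bool,
      (if edgeBit d x p.1 = true then (ω (ep d p.1 p.2) - ω (ep d p.1 (!p.2)))^2 else 0)}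

/-- The approximate negative witness size `w̃₋(x, P_{G_d})`: the least `‖ω ∘ A‖²` over
linear functionals `ω` with `ω(|s⟩ - |t⟩) = 1` achieving the negative error `e₋(x)`. -/
noncomputable def approxNegWit (d : ℕ) (x : Fin (2^(2*d)) → Bool) : ℝ :=
  sInf {r : ℝ | ∃ ω : Vtx d → ℝ, ω (sVtx d) - ω (tVtx d) = 1 ∧
    (∑ p : Edg d × Bool,
      (if edgeBit d x p.1 = true then (ω (ep d p.1 p.2) - ω (ep d p.1 (!p.2)))^2 else 0))
      = negErr d x ∧
    r = ∑ p : Edg d × Bool, (ω (ep d p.1 p.2) - ω (ep d p.1 (!p.2)))^2}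

/-- Weighted Dirichlet energy on `G_d`, each undirected edge counted once. -/
noncomputable def energy (d : ℕ) (c : Edg d → ℝ) (ω : Vtx d → ℝ) : ℝ :=
  ∑ e : Edg d, c e * (ω (ep d e false) - ω (ep d e true))^2

theorem sum_edg_succ (d : ℕ) (f : Edg (d+1) → ℝ) :
    ∑ e : Edg (d+1), f e = ∑ e : Edg d,
      (f (e, false, false) + f (e, false, true) + (f (e, true, false) + f (e, true, true))) := by
  have key : ∀ g : Edg d × Bool × Bool → ℝ, ∑ e : Edg d × Bool × Bool, g e = ∑ e : Edg d,
      (g (e, false, false) + g (e, false, true) + (g (e, true, false) + g (e, true, true))) := by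
    intro g
    rw [Fintype.sum_prod_type]
    refine Finset.sum_congr rfl fun e _ => ?_
    simp only [Fintype.sum_prod_type, Fintype.sum_bool]
    ring
  exact key f

theorem energy_succ (d : ℕ) (c : Edg (d+1) → ℝ) (ω : Vtx (d+1) → ℝ) :
    energy (d+1) c ω = ∑ e : Edg d,
      (c (e, false, false) * (ω (Sum.inl (ep d e false)) - ω (Sum.inr (e, false)))^2
      + c (e, false, true) * (ω (Sum.inr (e, false)) - ω (Sum.inl (ep d e true)))^2
      + (c (e, true, false) * (ω (Sum.inl (ep d e false)) - ω (Sum.inr (e, true)))^2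
      + c (e, true, true) * (ω (Sum.inr (e, true)) - ω (Sum.inl (ep d e true)))^2)) :=
  sum_edg_succ d _

theorem series_le (a b u v m : ℝ) (ha : 0 ≤ a) (hb : 0 ≤ b) :
    a * b / (a + b) * (u - v)^2 ≤ a * (u - m)^2 + b * (m - v)^2 := by
  rcases eq_or_lt_of_le (add_nonneg ha hb) with h | h
  · rw [← h]; simp; positivity
  · rw [div_mul_eq_mul_div, div_le_iff₀ h]
    nlinarith [sq_nonneg (a * (u - m) - b * (m - v))]

theorem series_eq (a b u v : ℝ) (ha : 0 ≤ a) (hb : 0 ≤ b) :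
    a * (u - (u - b / (a + b) * (u - v)))^2 + b * ((u - b / (a + b) * (u - v)) - v)^2
      = a * b / (a + b) * (u - v)^2 := by
  rcases eq_or_lt_of_le (add_nonneg ha hb) with h | h
  · have h1 : a = 0 := by linarith
    have h2 : b = 0 := by linarith
    simp [h1, h2]
  · field_simp
    ring

theorem split_le (a b u v : ℝ) (ha : 0 ≤ a) (hb : 0 ≤ b) :
    (u - (u - b / (a + b) * (u - v)))^2 + ((u - b / (a + b) * (u - v)) - v)^2
      ≤ (u - v)^2 := by
  have h0 : 0 ≤ b / (a + b) := by positivity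
  have h1 : b / (a + b) ≤ 1 := div_le_one_of_le₀ (by linarith) (by positivity)
  generalize b / (a + b) = p at *
  nlinarith [mul_nonneg (mul_nonneg h0 (sub_nonneg.2 h1)) (sq_nonneg (u - v))]

theorem exists_min (d : ℕ) : ∀ c : Edg d → ℝ, (∀ e, 0 ≤ c e) →
    ∃ ω : Vtx d → ℝ, ω (sVtx d) - ω (tVtx d) = 1 ∧
      (∀ ω' : Vtx d → ℝ, ω' (sVtx d) - ω' (tVtx d) = 1 → energy d c ω ≤ energy d c ω') ∧
      energy d (fun _ => 1) ω ≤ 2^d := by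
  induction d with
  | zero =>
    intro c _
    have key : ∀ (c : Edg 0 → ℝ) (ω : Vtx 0 → ℝ), ω (sVtx 0) - ω (tVtx 0) = 1 →
        energy 0 c ω = c () := by
      intro c ω h
      have h0 : energy 0 c ω = c () * (ω (sVtx 0) - ω (tVtx 0))^2 :=
        Fintype.sum_unique (ι := Unit) (fun e : Unit => c e * (ω (sVtx 0) - ω (tVtx 0))^2)
      rw [h0, h]; simp
    obtain ⟨w, h1⟩ : ∃ w : Vtx 0 → ℝ, w (sVtx 0) - w (tVtx 0) = 1 :=
      ⟨fun b : Bool => cond b (0:ℝ) 1, sub_zero 1⟩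
    refine ⟨w, h1, fun ω' h' => ?_, ?_⟩
    · rw [key _ _ h', key _ _ h1]
    · rw [key _ _ h1]; norm_num
  | succ d ih =>
    intro c hc
    obtain ⟨ω, h1, h2, h3⟩ := ih (fun e =>
      c (e, false, false) * c (e, false, true) / (c (e, false, false) + c (e, false, true))
      + c (e, true, false) * c (e, true, true) / (c (e, true, false) + c (e, true, true)))
      (fun e => by
        have := hc (e, false, false)
        have := hc (e, false, true)
        have := hc (e, true, false)
        have := hc (e, true, true)
        positivity)
    let w : Vtx (d+1) → ℝ := Sum.elim ω (fun p : Edg d × Bool =>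
      ω (ep d p.1 false) - c (p.1, p.2, true) / (c (p.1, p.2, false) + c (p.1, p.2, true))
        * (ω (ep d p.1 false) - ω (ep d p.1 true)))
    refine ⟨w, h1, fun ω' h' => ?_, ?_⟩
    · have hle := h2 (fun v => ω' (Sum.inl v)) h'
      refine le_trans (le_of_eq ?_) (hle.trans ?_)
      · rw [energy_succ, energy]
        refine Finset.sum_congr rfl fun e _ => ?_
        rw [add_mul]
        exact congrArg₂ (· + ·) (series_eq _ _ _ _ (hc _) (hc _))
          (series_eq _ _ _ _ (hc _) (hc _))
      · rw [energy_succ, energy]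
        refine Finset.sum_le_sum fun e _ => ?_
        rw [add_mul]
        exact add_le_add (series_le _ _ _ _ _ (hc _) (hc _)) (series_le _ _ _ _ _ (hc _) (hc _))
    · have : energy (d+1) (fun _ => 1) w ≤ 2 * energy d (fun _ => 1) ω := by
        rw [energy_succ, energy, Finset.mul_sum]
        refine Finset.sum_le_sum fun e _ => ?_
        simp only [one_mul]
        rw [two_mul]
        exact add_le_add (split_le _ _ _ _ (hc _) (hc _)) (split_le _ _ _ _ (hc _) (hc _))
      rw [pow_succ]; linarith

theorem sum_dir (d : ℕ) (P : Edg d → Prop) (ω : Vtx d → ℝ) :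
    (∑ p : Edg d × Bool,
      (if P p.1 then (ω (ep d p.1 p.2) - ω (ep d p.1 (!p.2)))^2 else 0))
      = 2 * energy d (fun e => if P e then 1 else 0) ω := by
  rw [Fintype.sum_prod_type, energy, Finset.mul_sum]
  refine Finset.sum_congr rfl fun e _ => ?_
  simp only [Fintype.sum_bool]
  by_cases h : P e <;> simp [h]
  ring

/-- `w̃₋(x, P_{G_d}) ≤ 2^(d+1)`. -/
theorem approxNegWit_le (d : ℕ) (x : Fin (2^(2*d)) → Bool) :
    approxNegWit d x ≤ 2^(d+1) := by
  obtain ⟨ω, h1, h2, h3⟩ := exists_min d (fun e => if edgeBit d x e = true then 1 else 0)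
    (fun e => by positivity)
  have hT : ∑ p : Edg d × Bool, (ω (ep d p.1 p.2) - ω (ep d p.1 (!p.2)))^2
      = 2 * energy d (fun _ => 1) ω := by
    simpa using sum_dir d (fun _ => True) ω
  have hneg : (∑ p : Edg d × Bool,
      (if edgeBit d x p.1 = true then (ω (ep d p.1 p.2) - ω (ep d p.1 (!p.2)))^2 else 0))
      = negErr d x := by
    symm
    refine IsLeast.csInf_eq ⟨⟨ω, h1, rfl⟩, ?_⟩
    rintro r ⟨ω', h', rfl⟩
    have := h2 ω' h'
    have e1 := sum_dir d (fun e => edgeBit d x e = true) ω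
    have e2 := sum_dir d (fun e => edgeBit d x e = true) ω'
    convert mul_le_mul_of_nonneg_left this (zero_le_two) using 1
    · convert e1
    · convert e2
  have hle : approxNegWit d x ≤ ∑ p : Edg d × Bool, (ω (ep d p.1 p.2) - ω (ep d p.1 (!p.2)))^2 := by
    refine csInf_le ⟨0, ?_⟩ ⟨ω, h1, hneg, rfl⟩
    rintro r ⟨ω', -, -, rfl⟩
    positivity
  rw [hT] at hle
  rw [pow_succ]; linarith

end NandTree
end
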